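/- arXiv:1806.06430 — 3 statements merged into one kernel-verified Lean document; each statement's English description precedes it below -/
import Mathlib

section
/- Let $G$ be a function with property $\mathcal{P}$. Then there exists a constant $\alpha_G>0$ (which may depend on $G$) such that for all $a,b\ge 0$ with $ab\le 1$, one has $G(a)\,G(b)\le \alpha_G\,G(ab)$. -/
open MeasureTheory ProbabilityTheory Real Filter
open scoped ENNReal NNReal

noncomputable section

/-- The Orlicz norm on `ℝⁿ` induced by a function `G`. -/
def OrliczNorm (G : ℝ → ℝ) {n : ℕ} (x : Fin n → ℝ) : ℝ :=
  sInf {α : ℝ | 0 < α ∧ ∑ i, G (|x i| / α) ≤ 1}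

/-- The `ℓ₁` norm of a vector. -/
def l1Norm {n : ℕ} (x : Fin n → ℝ) : ℝ := ∑ i, |x i|

/-- The `ℓ₂` norm of a vector. -/
def l2Norm {n : ℕ} (x : Fin n → ℝ) : ℝ := Real.sqrt (∑ i, (x i) ^ 2)

/-- The `ℓ∞` norm of a vector. -/
def linfNorm {n : ℕ} (x : Fin n → ℝ) : ℝ := ⨆ i, |x i|

/-- Property 𝒫 from the paper, with growth constant `CG` (condition (5)). -/
structure PropertyP (G : ℝ → ℝ) (CG : ℝ) : Prop where
  nonneg : ∀ x, 0 ≤ G x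
  nonzero : ∃ x, 0 ≤ x ∧ G x ≠ 0
  mono : MonotoneOn G (Set.Ici 0)
  convex : ConvexOn ℝ (Set.Ici 0) G
  zero : G 0 = 0
  one : G 1 = 1
  even : ∀ x, G x = G (-x)
  linear : ∃ s > (0:ℝ), ∀ x > (1:ℝ), G x = s * x + (1 - s)
  smooth : ∃ δG > (0:ℝ), (∀ x ∈ Set.Ioo (0:ℝ) δG, DifferentiableAt ℝ G x ∧
      DifferentiableAt ℝ (deriv G) x) ∧
    ∃ c₁ c₂ : ℝ, HasDerivWithinAt G c₁ (Set.Ici 0) 0 ∧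
      Filter.Tendsto (fun h => (deriv G h - c₁) / h) (nhdsWithin 0 (Set.Ioi 0)) (nhds c₂) ∧
      (0 < c₁ ∨ 0 < c₂)
  CG_pos : 0 < CG
  growth : ∀ x y : ℝ, 0 < x → x < y → G y / G x ≤ CG * (y / x) ^ 2

/-- `u` is a nonnegative (measurable) random variable with cumulative distribution function
`t ↦ 1 - exp (-G t)` on `[0,∞)`. -/
def HasExpGCDF {Ω : Type} [MeasurableSpace Ω] (μ : Measure Ω) (G : ℝ → ℝ) (u : Ω → ℝ) : Prop :=
  Measurable u ∧ (∀ ω, 0 ≤ u ω) ∧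
    ∀ t : ℝ, 0 ≤ t → μ {ω | u ω ≤ t} = ENNReal.ofReal (1 - Real.exp (-(G t)))


lemma orlicz_scale (G : ℝ → ℝ) (CG : ℝ) (hG : PropertyP G CG) (t x : ℝ)
    (ht : 0 ≤ t) (ht1 : t ≤ 1) (hx : 0 ≤ x) : G (t * x) ≤ t * G x := by
  have h := hG.convex.2 (Set.mem_Ici.2 hx) (Set.mem_Ici.2 (le_refl (0:ℝ))) ht
    (sub_nonneg.2 ht1) (by ring)
  simpa [hG.zero] using h

/-- On the unit interval. -/
lemma orlicz_small (G : ℝ → ℝ) (CG : ℝ) (hG : PropertyP G CG) :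
    ∃ K > (0:ℝ), ∀ a b : ℝ, 0 ≤ a → 0 ≤ b → a ≤ 1 → b ≤ 1 → G a * G b ≤ K * G (a * b) := by
  obtain ⟨δ, hδ, hdiff, c₁, c₂, hd, ht, hc⟩ := hG.smooth
  have hslope : Tendsto (fun x => G x / x) (nhdsWithin 0 (Set.Ioi 0)) (nhds c₁) := by
    have h1 := (hasDerivWithinAt_iff_tendsto_slope.1 hd)
    have h2 : Set.Ici (0:ℝ) \ {0} = Set.Ioi 0 := by
      ext x; simp [lt_iff_le_and_ne, eq_comm]
    rw [h2] at h1
    refine h1.congr fun x => ?_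
    simp [slope_def_field, hG.zero]
  have hle1 : ∀ x, 0 ≤ x → x ≤ 1 → G x ≤ x := by
    intro x h0 h1
    have := orlicz_scale G CG hG x 1 h0 h1 zero_le_one
    simpa [hG.one] using this
  have hc1 : 0 ≤ c₁ := by
    refine ge_of_tendsto hslope ?_
    filter_upwards [self_mem_nhdsWithin] with x hx
    exact div_nonneg (hG.nonneg x) (le_of_lt hx)
  rcases hc1.lt_or_eq with hpos | hzero
  · have hlow : ∀ x, 0 ≤ x → c₁ * x ≤ G x := by
      intro x hx
      rcases hx.lt_or_eq with hx | rfl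
      · rw [← le_div_iff₀ hx]
        refine le_of_tendsto hslope ?_
        filter_upwards [Ioc_mem_nhdsGT hx] with y hy
        have h := orlicz_scale G CG hG (y / x) x (by have := hy.1; positivity)
          ((div_le_one hx).2 hy.2) hx.le
        rw [div_mul_cancel₀ _ hx.ne'] at h
        rw [div_le_iff₀ hy.1]
        calc G y ≤ y / x * G x := h
          _ = G x / x * y := by ring
      · simp [hG.zero]
    refine ⟨1 / c₁, by positivity, fun a b ha hb ha1 hb1 => ?_⟩
    have h1 := mul_le_mul (hle1 a ha ha1) (hle1 b hb hb1) (hG.nonneg b) ha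
    have h2 := hlow (a * b) (by positivity)
    rw [div_mul_eq_mul_div, le_div_iff₀ hpos]
    nlinarith
  · subst hzero
    have hc2 : 0 < c₂ := by simpa using hc
    have hev : ∀ᶠ h in nhdsWithin (0:ℝ) (Set.Ioi 0),
        (deriv G h - 0) / h ∈ Set.Ioo (c₂ / 2) (c₂ + 1) :=
      ht (Ioo_mem_nhds (by linarith) (by linarith))
    obtain ⟨ε, hε, hεs⟩ := (mem_nhdsGT_iff_exists_Ioo_subset).1 hev
    have hε : 0 < ε := hε
    obtain ⟨η, hη, hη1, hηδ, hηε⟩ : ∃ η > (0:ℝ), η ≤ 1 ∧ η < δ ∧ η < ε := by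
      refine ⟨min 1 (min (δ/2) (ε/2)), by positivity, min_le_left _ _, ?_, ?_⟩
      · exact lt_of_le_of_lt ((min_le_right _ _).trans (min_le_left _ _)) (by linarith)
      · exact lt_of_le_of_lt ((min_le_right _ _).trans (min_le_right _ _)) (by linarith)
    have hder : ∀ x, 0 < x → x ≤ η → c₂ / 2 * x < deriv G x ∧ deriv G x < (c₂ + 1) * x := by
      intro x hx hxη
      have h : (deriv G x - 0) / x ∈ Set.Ioo (c₂ / 2) (c₂ + 1) := hεs ⟨hx, by linarith⟩
      rw [sub_zero] at h
      exact ⟨(lt_div_iff₀ hx).1 h.1, (div_lt_iff₀ hx).1 h.2⟩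
    have hD : ∀ x, 0 < x → x ≤ η → DifferentiableAt ℝ G x := fun x hx hxη =>
      (hdiff x ⟨hx, by linarith⟩).1
    have hup : ∀ x, 0 < x → x ≤ η → G x ≤ (c₂ + 1) * x ^ 2 := by
      intro x hx hxη
      obtain ⟨ξ, hξ, he⟩ := exists_deriv_eq_slope G hx (by
        intro y hy
        rcases hy.1.lt_or_eq with h | rfl
        · exact (hD y h (hy.2.trans hxη)).continuousAt.continuousWithinAt
        · exact hd.continuousWithinAt.mono Set.Icc_subset_Ici_self)
        (fun y hy => (hD y hy.1 (hy.2.le.trans hxη)).differentiableWithinAt)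
      have h1 := (hder ξ hξ.1 (hξ.2.le.trans hxη)).2
      rw [he, hG.zero, sub_zero, sub_zero, div_lt_iff₀ hx] at h1
      have : (c₂ + 1) * ξ * x ≤ (c₂ + 1) * x * x := by
        have := hξ.2.le
        gcongr
      nlinarith
    have hlo : ∀ x, 0 < x → x ≤ η → c₂ / 8 * x ^ 2 ≤ G x := by
      intro x hx hxη
      obtain ⟨ξ, hξ, he⟩ := exists_deriv_eq_slope G (half_lt_self hx) (by
        intro y hy
        have h : 0 < y := by linarith [hy.1]
        exact (hD y h (hy.2.trans hxη)).continuousAt.continuousWithinAt)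
        (fun y hy => (hD y (by linarith [hy.1]) (hy.2.le.trans hxη)).differentiableWithinAt)
      have h1 := (hder ξ (by linarith [hξ.1]) (hξ.2.le.trans hxη)).1
      rw [he, lt_div_iff₀ (by linarith)] at h1
      have : c₂ / 2 * (x / 2) * (x - x / 2) ≤ c₂ / 2 * ξ * (x - x / 2) := by
        have := hξ.1.le
        have : 0 ≤ x - x / 2 := by linarith
        gcongr
      have := hG.nonneg (x / 2)
      nlinarith
    have hGη : 0 < G η := lt_of_lt_of_le (by positivity) (hlo η hη le_rfl)
    obtain ⟨U, hU, hUp⟩ : ∃ U > (0:ℝ), ∀ x, 0 ≤ x → x ≤ 1 → G x ≤ U * x ^ 2 := by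
      refine ⟨(c₂ + 1) + 1 / η ^ 2, by positivity, fun x hx hx1 => ?_⟩
      rcases hx.lt_or_eq with hx | rfl
      · rcases le_total x η with h | h
        · have := hup x hx h
          have : 0 ≤ 1 / η ^ 2 * x ^ 2 := by positivity
          nlinarith
        · have h1 := hle1 x hx.le hx1
          have h2 : 1 ≤ 1 / η ^ 2 * x ^ 2 := by
            rw [one_div_mul_eq_div, le_div_iff₀ (by positivity), one_mul]
            gcongr
          have : 0 ≤ (c₂ + 1) * x ^ 2 := by positivity
          nlinarith
      · simp [hG.zero]
    obtain ⟨L, hL, hLo⟩ : ∃ L > (0:ℝ), ∀ x, 0 ≤ x → x ≤ 1 → L * x ^ 2 ≤ G x := by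
      refine ⟨min (c₂ / 8) (G η), by positivity, fun x hx hx1 => ?_⟩
      rcases hx.lt_or_eq with hx | rfl
      · rcases le_total x η with h | h
        · refine le_trans ?_ (hlo x hx h)
          gcongr
          exact min_le_left _ _
        · have h1 := hG.mono (Set.mem_Ici.2 hη.le) (Set.mem_Ici.2 hx.le) h
          refine le_trans ?_ h1
          calc min (c₂ / 8) (G η) * x ^ 2 ≤ G η * 1 := by
                gcongr
                · exact min_le_right _ _
                · nlinarith
            _ = G η := mul_one _
      · simp [hG.zero]
    refine ⟨U ^ 2 / L, by positivity, fun a b ha hb ha1 hb1 => ?_⟩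
    have h1 := mul_le_mul (hUp a ha ha1) (hUp b hb hb1) (hG.nonneg b) (by positivity)
    have h2 := hLo (a * b) (by positivity) (by nlinarith)
    calc G a * G b ≤ U * a ^ 2 * (U * b ^ 2) := h1
      _ = U ^ 2 / L * (L * (a * b) ^ 2) := by field_simp
      _ ≤ _ := by gcongr

/-- Lemma 6: for `G` with property 𝒫 there is a constant `αG > 0` such that
`G a * G b ≤ αG * G (a*b)` whenever `a, b ≥ 0` and `a*b ≤ 1`. -/
theorem orlicz_decompose (G : ℝ → ℝ) (CG : ℝ) (hG : PropertyP G CG) :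
    ∃ αG > (0:ℝ), ∀ a b : ℝ, 0 ≤ a → 0 ≤ b → a * b ≤ 1 → G a * G b ≤ αG * G (a * b) := by
  obtain ⟨K, hK, hsmall⟩ := orlicz_small G CG hG
  obtain ⟨s, hs, hlin⟩ := hG.linear
  have hbig : ∀ a b : ℝ, 1 < a → 0 ≤ b → a * b ≤ 1 → G a * G b ≤ (s + 1) * G (a * b) := by
    intro a b ha hb hab
    have ha0 : 0 < a := by linarith
    have h1 : G a ≤ (s + 1) * a := by rw [hlin a ha]; nlinarith
    have h2 := orlicz_scale G CG hG (1 / a) (a * b) (by positivity)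
      ((div_le_one ha0).2 ha.le) (by positivity)
    have h3 : 1 / a * (a * b) = b := by field_simp
    rw [h3, one_div_mul_eq_div, le_div_iff₀ ha0] at h2
    calc G a * G b ≤ (s + 1) * a * G b := mul_le_mul_of_nonneg_right h1 (hG.nonneg b)
      _ = (s + 1) * (G b * a) := by ring
      _ ≤ _ := by gcongr
  refine ⟨K + (s + 1), by positivity, fun a b ha hb hab => ?_⟩
  have hn := hG.nonneg (a * b)
  have hKn : 0 ≤ K * G (a * b) := by positivity
  have hsn : 0 ≤ (s + 1) * G (a * b) := by positivity
  rcases lt_or_ge 1 a with h | h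
  · have := hbig a b h hb hab
    nlinarith
  rcases lt_or_ge 1 b with h' | h'
  · have := hbig b a h' ha (by rwa [mul_comm])
    rw [mul_comm b a] at this
    nlinarith
  · have := hsmall a b ha hb h h'
    nlinarith
end
end

section
/- Let $G$ be a function with property $\mathcal{P}$ and let $\|\cdot\|_G$ be the Orlicz norm induced by $G$. There exist constants $c,c'>0$ depending only on $G$ such that the following holds for every $n\ge 2$ and every $x\in\mathbb{R}^n$: let $u_1,\dots,u_n$ be nonnegative random variables (not necessarily independent) each with marginal cumulative distribution function $t\mapsto 1-e^{-G(t)}$ on $[0,\infty)$, and let $f(x)=(x_1/u_1,\dots,x_n/u_n)$. Then for every $\delta\in(0,1)$, with probability at least $1-\delta-c'/n^{19}$, one has $\|f(x)\|_G\le c\,\alpha_G\,\delta^{-1}\log(n)\,\|x\|_G$, where $\alpha_G$ is a constant depending only on $G$ satisfying $G(a)G(b)\le\alpha_G G(ab)$ for all $a,b\ge 0$ with $ab\le 1$. -/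
open MeasureTheory ProbabilityTheory Real Filter
open scoped ENNReal NNReal

noncomputable section

lemma PropertyP.scale {G : ℝ → ℝ} {CG : ℝ} (hG : PropertyP G CG) {v R : ℝ} (hv : 0 ≤ v)
    (hR : 1 ≤ R) : G (v / R) ≤ G v / R := by
  have hR0 : 0 < R := by linarith
  have ha : (0:ℝ) ≤ 1 / R := by positivity
  have hb : 0 ≤ 1 - 1 / R := by rw [sub_nonneg, div_le_one hR0]; exact hR
  have h := hG.convex.2 (show v ∈ Set.Ici (0:ℝ) from hv) (show (0:ℝ) ∈ Set.Ici (0:ℝ) by simp)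
    ha hb (by ring)
  simp only [smul_eq_mul, mul_zero, add_zero, hG.zero] at h
  calc G (v / R) = G (1 / R * v) := by congr 1; ring
    _ ≤ _ := h
    _ = _ := by ring

lemma PropertyP.le_one {G : ℝ → ℝ} {CG : ℝ} (hG : PropertyP G CG) {v : ℝ}
    (hv : G v ≤ 1) : v ≤ 1 := by
  by_contra! h
  obtain ⟨s, hs, hl⟩ := hG.linear
  rw [hl v h] at hv
  nlinarith

lemma PropertyP.contOn {G : ℝ → ℝ} {CG : ℝ} (hG : PropertyP G CG) :
    ContinuousOn G (Set.Ici 0) := by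
  intro t ht
  rcases eq_or_lt_of_le (show (0:ℝ) ≤ t from ht) with h | h
  · obtain ⟨_, _, _, c₁, c₂, h1, _⟩ := hG.smooth
    rw [← h]
    exact h1.continuousWithinAt
  · have := hG.convex.continuousOn_interior
    rw [interior_Ici] at this
    exact (this.continuousAt (Ioi_mem_nhds h)).continuousWithinAt

lemma PropertyP.exists_level {G : ℝ → ℝ} {CG : ℝ} (hG : PropertyP G CG) (k : ℕ) :
    ∃ t, 0 ≤ t ∧ G t = (1 / 2 : ℝ) ^ k := by
  have h := intermediate_value_Icc (zero_le_one' ℝ)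
    (hG.contOn.mono (fun t ht => ht.1 : Set.Icc (0:ℝ) 1 ⊆ Set.Ici 0))
  rw [hG.zero, hG.one] at h
  obtain ⟨t, ht, h2⟩ := h (show (1 / 2 : ℝ) ^ k ∈ Set.Icc (0:ℝ) 1 from
    ⟨by positivity, pow_le_one₀ (by norm_num) (by norm_num)⟩)
  exact ⟨t, ht.1, h2⟩

lemma PropertyP.inv_bound {G : ℝ → ℝ} {CG : ℝ} (hG : PropertyP G CG) (τ : ℕ → ℝ)
    (hτ0 : ∀ k, 0 ≤ τ k) (hτ : ∀ k, G (τ k) = (1 / 2 : ℝ) ^ k) (v : ℝ) (K : ℕ) (hv : τ K < v) :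
    (G v)⁻¹ ≤ 1 + ∑ k ∈ Finset.range K, 2 ^ (k + 1) * (if v ≤ τ k then (1:ℝ) else 0) := by
  have key : ∀ k, τ k < v → (G v)⁻¹ ≤ 2 ^ k := by
    intro k hk
    have h1 : (1 / 2 : ℝ) ^ k ≤ G v := by
      rw [← hτ k]
      exact hG.mono (hτ0 k) ((hτ0 k).trans hk.le) hk.le
    calc (G v)⁻¹ ≤ ((1 / 2 : ℝ) ^ k)⁻¹ := inv_anti₀ (by positivity) h1
      _ = 2 ^ k := by simp
  induction K with
  | zero => simpa using key 0 hv
  | succ K ih =>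
    rw [Finset.sum_range_succ]
    by_cases h : v ≤ τ K
    · have h0 : (0:ℝ) ≤ ∑ k ∈ Finset.range K, 2 ^ (k + 1) * (if v ≤ τ k then (1:ℝ) else 0) :=
        Finset.sum_nonneg fun k _ => by split_ifs <;> simp
      have := key _ hv
      rw [if_pos h]
      linarith
    · have := ih (not_le.mp h)
      rw [if_neg h]
      linarith

lemma OrliczNorm_le {G : ℝ → ℝ} {n : ℕ} (x : Fin n → ℝ) {β : ℝ} (hβ : 0 < β)
    (h : ∑ i, G (|x i| / β) ≤ 1) : OrliczNorm G x ≤ β :=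
  csInf_le ⟨0, fun _ ha => ha.1.le⟩ ⟨hβ, h⟩

lemma PropertyP.set_nonempty {G : ℝ → ℝ} {CG : ℝ} (hG : PropertyP G CG) {n : ℕ}
    (x : Fin n → ℝ) : {α : ℝ | 0 < α ∧ ∑ i, G (|x i| / α) ≤ 1}.Nonempty := by
  have h0 : 0 ≤ ∑ i, G (|x i|) := Finset.sum_nonneg fun i _ => hG.nonneg _
  refine ⟨1 + ∑ i, G (|x i|), by positivity, ?_⟩
  calc ∑ i, G (|x i| / (1 + ∑ i, G (|x i|))) ≤ ∑ i, G (|x i|) / (1 + ∑ i, G (|x i|)) :=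
        Finset.sum_le_sum fun i _ => hG.scale (abs_nonneg _) (by linarith)
    _ = (∑ i, G (|x i|)) / (1 + ∑ i, G (|x i|)) := by rw [Finset.sum_div]
    _ ≤ 1 := by rw [div_le_one (by positivity)]; linarith

lemma PropertyP.norm_pos {G : ℝ → ℝ} {CG : ℝ} (hG : PropertyP G CG) {n : ℕ}
    (x : Fin n → ℝ) (i : Fin n) (hi : x i ≠ 0) : 0 < OrliczNorm G x := by
  refine lt_of_lt_of_le (abs_pos.mpr hi) (le_csInf (hG.set_nonempty x) ?_)
  rintro a ⟨ha, hs⟩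
  have h1 : G (|x i| / a) ≤ 1 :=
    (Finset.single_le_sum (f := fun i => G (|x i| / a)) (fun j _ => hG.nonneg _)
      (Finset.mem_univ i)).trans hs
  have := hG.le_one h1
  rwa [div_le_one ha] at this

lemma PropertyP.norm_two {G : ℝ → ℝ} {CG : ℝ} (hG : PropertyP G CG) {n : ℕ}
    (x : Fin n → ℝ) (hN : 0 < OrliczNorm G x) :
    ∑ i, G (|x i| / (2 * OrliczNorm G x)) ≤ 1 := by
  obtain ⟨a, ⟨ha, hs⟩, hlt⟩ := exists_lt_of_csInf_lt (hG.set_nonempty x)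
    (show OrliczNorm G x < 2 * OrliczNorm G x by linarith)
  refine le_trans (Finset.sum_le_sum fun i _ => ?_) hs
  refine hG.mono (show (0:ℝ) ≤ _ by positivity) (show (0:ℝ) ≤ _ by positivity) ?_
  gcongr

lemma exists_scale (n : ℕ) (hn : 2 ≤ n) : ∃ k : ℕ, (n : ℝ) ≤ 2 ^ k ∧
    1 + 2 * ((20 * k : ℕ) : ℝ) ≤ 122 * Real.log n := by
  have hl2 := Real.log_two_gt_d9
  have hln : Real.log 2 ≤ Real.log n := Real.log_le_log (by norm_num) (by exact_mod_cast hn)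
  refine ⟨Nat.clog 2 n, by exact_mod_cast Nat.le_pow_clog (by norm_num) n, ?_⟩
  have h1 : 2 ^ (Nat.clog 2 n - 1) < n := Nat.pow_pred_clog_lt_self (by norm_num) (by omega)
  have hc : 1 ≤ Nat.clog 2 n := Nat.clog_pos (by norm_num) hn
  obtain ⟨m, hm⟩ : ∃ m, Nat.clog 2 n = m + 1 := ⟨_, (Nat.sub_add_cancel hc).symm⟩
  rw [hm] at h1 ⊢
  have h2 : (m : ℝ) * Real.log 2 ≤ Real.log n := by
    rw [← Real.log_pow]
    exact Real.log_le_log (by positivity) (by exact_mod_cast h1.le)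
  push_cast
  have hm0 : (0:ℝ) ≤ m := Nat.cast_nonneg m
  nlinarith

/-- Theorem 9 (dilation bound for a fixed vector): if each `uᵢ` (not necessarily independent)
has marginal CDF `1 - exp (-G t)`, then with probability at least `1 - δ - c'/n¹⁹`,
`‖(x₁/u₁, …, xₙ/uₙ)‖_G ≤ c αG δ⁻¹ log n · ‖x‖_G`. -/
theorem orlicz_dilation_fixed_vector (G : ℝ → ℝ) (CG : ℝ) (hG : PropertyP G CG)
    (αG : ℝ) (hαG_pos : 0 < αG)
    (hαG : ∀ a b : ℝ, 0 ≤ a → 0 ≤ b → a * b ≤ 1 → G a * G b ≤ αG * G (a * b)) :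
    ∃ c > (0:ℝ), ∃ c' > (0:ℝ),
      ∀ (n : ℕ), 2 ≤ n → ∀ x : Fin n → ℝ,
      ∀ (Ω : Type) [MeasurableSpace Ω] (μ : Measure Ω), IsProbabilityMeasure μ →
      ∀ u : Fin n → Ω → ℝ, (∀ i, HasExpGCDF μ G (u i)) →
      ∀ δ : ℝ, 0 < δ → δ < 1 →
        ENNReal.ofReal (1 - δ - c' / (n : ℝ) ^ 19) ≤
          μ {ω | OrliczNorm G (fun i => x i / u i ω) ≤
            c * αG * δ⁻¹ * Real.log n * OrliczNorm G x} := by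
  have hα1 : 1 ≤ αG := by
    have := hαG 1 1 (by norm_num) (by norm_num) (by norm_num)
    simpa [hG.one] using this
  refine ⟨244, by norm_num, 1, by norm_num, ?_⟩
  intro n hn x Ω _ μ hμ u hu δ hδ0 hδ1
  have hn0 : (0:ℝ) < n := by exact_mod_cast (by omega : 0 < n)
  by_cases hx : ∀ i, x i = 0
  · have h0 : OrliczNorm G x = 0 := by
      simp [OrliczNorm, hx, hG.zero]
      exact csInf_Ioi
    have h1 : ∀ ω, (fun i => x i / u i ω) = x := fun ω => by funext i; simp [hx]
    simp only [h1, h0, mul_zero, le_refl, Set.setOf_true, measure_univ]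
    rw [ENNReal.ofReal_le_one]
    have : (0:ℝ) ≤ 1 / (n:ℝ) ^ 19 := by positivity
    linarith
  push Not at hx
  obtain ⟨i₀, hi₀⟩ := hx
  have hN := hG.norm_pos x i₀ hi₀
  have hsum := hG.norm_two x hN
  set N := OrliczNorm G x with hNdef
  set y : Fin n → ℝ := fun i => |x i| / (2 * N) with hy
  have hy0 : ∀ i, 0 ≤ y i := fun i => by positivity
  have hy1 : ∀ i, y i ≤ 1 := fun i => hG.le_one <|
    (Finset.single_le_sum (f := fun i => G (y i)) (fun j _ => hG.nonneg _)
      (Finset.mem_univ i)).trans hsum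
  obtain ⟨k, hk1, hk2⟩ := exists_scale n hn
  choose τ hτ0 hτ using hG.exists_level
  set K := 20 * k with hK
  set M : ℝ := 1 + 2 * (K : ℝ) with hM
  have hM1 : 1 ≤ M := by rw [hM]; linarith [(Nat.cast_nonneg K : (0:ℝ) ≤ K)]
  have hms : ∀ i j, MeasurableSet {ω | u i ω ≤ τ j} := fun i j =>
    measurableSet_le (hu i).1 measurable_const
  have hprob : ∀ i j, μ.real {ω | u i ω ≤ τ j} ≤ (1 / 2 : ℝ) ^ j := by
    intro i j
    rw [measureReal_def, (hu i).2.2 _ (hτ0 j), hτ j]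
    refine ENNReal.toReal_le_of_le_ofReal (by positivity) (ENNReal.ofReal_le_ofReal ?_)
    linarith [Real.add_one_le_exp (-((1 / 2 : ℝ) ^ j))]
  set I : Fin n → ℕ → Ω → ℝ := fun i j ω => if u i ω ≤ τ j then (1:ℝ) else 0 with hI
  have hIeq : ∀ i j, I i j = Set.indicator {ω | u i ω ≤ τ j} 1 := by
    intro i j
    funext ω
    simp [hI, Set.indicator_apply]
  have hIint : ∀ i j, Integrable (I i j) μ := by
    intro i j
    rw [hIeq]
    exact (integrable_const (1:ℝ)).indicator (hms i j)
  have hIval : ∀ i j, ∫ ω, I i j ω ∂μ ≤ (1 / 2 : ℝ) ^ j := by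
    intro i j
    rw [hIeq, integral_indicator_one (hms i j)]
    exact hprob i j
  have hI0 : ∀ i j ω, 0 ≤ I i j ω := by
    intro i j ω
    simp only [hI]
    split_ifs <;> norm_num
  set V : Fin n → Ω → ℝ := fun i ω => 1 + ∑ j ∈ Finset.range K, 2 ^ (j + 1) * I i j ω with hV
  have hSint : ∀ i, Integrable (fun ω => ∑ j ∈ Finset.range K, 2 ^ (j + 1) * I i j ω) μ :=
    fun i => integrable_finset_sum _ fun j _ => (hIint i j).const_mul _
  have hVint : ∀ i, Integrable (V i) μ := fun i => (integrable_const _).add (hSint i)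
  have hV0 : ∀ i ω, 0 ≤ V i ω := fun i ω =>
    add_nonneg zero_le_one (Finset.sum_nonneg fun j _ => mul_nonneg (by positivity) (hI0 i j ω))
  have hVval : ∀ i, ∫ ω, V i ω ∂μ ≤ M := by
    intro i
    simp only [hV]
    rw [integral_add (integrable_const _) (hSint i),
      integral_finset_sum _ fun j _ => (hIint i j).const_mul _]
    simp only [integral_const_mul, integral_const, probReal_univ, smul_eq_mul, mul_one]
    have : ∑ j ∈ Finset.range K, 2 ^ (j + 1) * ∫ ω, I i j ω ∂μ ≤ ∑ j ∈ Finset.range K, (2:ℝ) := by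
      refine Finset.sum_le_sum fun j _ => ?_
      calc (2:ℝ) ^ (j + 1) * ∫ ω, I i j ω ∂μ ≤ 2 ^ (j + 1) * (1 / 2 : ℝ) ^ j := by
            gcongr
            exact hIval i j
        _ = 2 * (2 * (1 / 2 : ℝ)) ^ j := by rw [mul_pow]; ring
        _ = 2 := by norm_num
    rw [Finset.sum_const, Finset.card_range, nsmul_eq_mul] at this
    rw [hM]
    linarith
  set W : Ω → ℝ := fun ω => ∑ i, G (y i) * V i ω with hW
  have hWint : Integrable W μ := integrable_finset_sum _ fun i _ => (hVint i).const_mul _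
  have hW0 : ∀ ω, 0 ≤ W ω := fun ω =>
    Finset.sum_nonneg fun i _ => mul_nonneg (hG.nonneg _) (hV0 i ω)
  have hWval : ∫ ω, W ω ∂μ ≤ M := by
    simp only [hW]
    rw [integral_finset_sum _ fun i _ => (hVint i).const_mul _]
    simp only [integral_const_mul]
    calc ∑ i, G (y i) * ∫ ω, V i ω ∂μ ≤ ∑ i, G (y i) * M :=
          Finset.sum_le_sum fun i _ => mul_le_mul_of_nonneg_left (hVval i) (hG.nonneg _)
      _ = (∑ i, G (y i)) * M := by rw [Finset.sum_mul]
      _ ≤ 1 * M := by gcongr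
      _ = M := one_mul M
  have hmarkov : μ.real {ω | M / δ ≤ W ω} ≤ δ := by
    have h := mul_meas_ge_le_integral_of_nonneg (Eventually.of_forall hW0) hWint (M / δ)
    have h2 : M / δ * μ.real {ω | M / δ ≤ W ω} ≤ M := h.trans hWval
    have hMp : 0 < M := by linarith
    rw [div_mul_eq_mul_div, div_le_iff₀ hδ0] at h2
    exact le_of_mul_le_mul_left h2 hMp
  have hbad : μ.real (⋃ i, {ω | u i ω ≤ τ K}) ≤ 1 / (n:ℝ) ^ 19 := by
    calc μ.real (⋃ i, {ω | u i ω ≤ τ K}) ≤ ∑ i, μ.real {ω | u i ω ≤ τ K} :=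
          measureReal_iUnion_fintype_le _
      _ ≤ ∑ i : Fin n, (1 / 2 : ℝ) ^ K := Finset.sum_le_sum fun i _ => hprob i K
      _ = n * (1 / ((2:ℝ) ^ k) ^ 20) := by
          rw [Finset.sum_const, Finset.card_univ, Fintype.card_fin, nsmul_eq_mul, hK, ← pow_mul,
            mul_comm k 20, one_div_pow]
      _ ≤ n * (1 / (n:ℝ) ^ 20) := by gcongr
      _ = 1 / (n:ℝ) ^ 19 := by field_simp
  have hWm : NullMeasurableSet {ω | M / δ ≤ W ω} μ :=
    nullMeasurableSet_le aemeasurable_const hWint.aemeasurable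
  set B : Set Ω := {ω | M / δ ≤ W ω} ∪ ⋃ i, {ω | u i ω ≤ τ K} with hB
  have hBm : NullMeasurableSet B μ :=
    hWm.union (MeasurableSet.iUnion fun i => hms i K).nullMeasurableSet
  have hBle : μ.real B ≤ δ + 1 / (n:ℝ) ^ 19 :=
    (measureReal_union_le _ _).trans (add_le_add hmarkov hbad)
  have hsub : Bᶜ ⊆ {ω | OrliczNorm G (fun i => x i / u i ω) ≤
            244 * αG * δ⁻¹ * Real.log n * N} := by
    intro ω hω
    simp only [hB, Set.mem_compl_iff, Set.mem_union, Set.mem_iUnion, Set.mem_setOf_eq, not_or,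
      not_exists, not_le] at hω
    obtain ⟨hω1, hω2⟩ := hω
    set R : ℝ := αG * (M / δ) with hR
    have hMδ : 1 ≤ M / δ := by rw [one_le_div hδ0]; linarith
    have hR1 : 1 ≤ R := one_le_mul_of_one_le_of_one_le hα1 hMδ
    have hR0 : 0 < R := by linarith
    have hstep : ∀ i, G (|x i / u i ω| / (2 * N * R)) ≤ αG * (G (y i) * V i ω) / R := by
      intro i
      have hu0 : 0 < u i ω := (hτ0 K).trans_lt (hω2 i)
      have e1 : |x i / u i ω| / (2 * N * R) = (y i / u i ω) / R := by
        rw [abs_div, abs_of_pos hu0, hy]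
        field_simp
      have hGu : 0 < G (u i ω) := by
        refine lt_of_lt_of_le ?_ (hG.mono (hτ0 K) hu0.le (hω2 i).le)
        rw [hτ]
        positivity
      have hinv : (G (u i ω))⁻¹ ≤ V i ω := hG.inv_bound τ hτ0 hτ (u i ω) K (hω2 i)
      have e2 : u i ω * (y i / u i ω) = y i := by field_simp
      have h1 := hαG (u i ω) (y i / u i ω) hu0.le (div_nonneg (hy0 i) hu0.le)
        (by rw [e2]; exact hy1 i)
      rw [e2] at h1
      have h2 : G (y i / u i ω) ≤ αG * (G (y i) * V i ω) := by
        calc G (y i / u i ω) = (G (u i ω) * G (y i / u i ω)) * (G (u i ω))⁻¹ := by field_simp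
          _ ≤ (αG * G (y i)) * V i ω :=
            mul_le_mul h1 hinv (by positivity) (mul_nonneg hαG_pos.le (hG.nonneg _))
          _ = _ := by ring
      rw [e1]
      exact (hG.scale (div_nonneg (hy0 i) hu0.le) hR1).trans (by gcongr)
    have hfin : ∑ i, G (|x i / u i ω| / (2 * N * R)) ≤ 1 := by
      refine (Finset.sum_le_sum fun i _ => hstep i).trans ?_
      rw [← Finset.sum_div, ← Finset.mul_sum, div_le_one hR0]
      exact mul_le_mul_of_nonneg_left hω1.le hαG_pos.le
    refine (OrliczNorm_le (fun i => x i / u i ω) (by positivity) hfin).trans ?_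
    calc 2 * N * R = M * (2 * N * αG * δ⁻¹) := by rw [hR]; ring
      _ ≤ (122 * Real.log n) * (2 * N * αG * δ⁻¹) := by gcongr
      _ = _ := by ring
  refine le_trans ?_ (measure_mono hsub)
  have hc : μ.real Bᶜ = 1 - μ.real B := by
    rw [measureReal_compl₀ hBm, probReal_univ]
  rw [← ofReal_measureReal]
  apply ENNReal.ofReal_le_ofReal
  linarith
end
end

section
/- Let $G$ be a function with property $\mathcal{P}$ and let $\|\cdot\|_G$ be the Orlicz norm induced by $G$. For every matrix $A\in\mathbb{R}^{n\times m}$ of rank $d$, there exists a matrix $U\in\mathbb{R}^{n\times d}$ which is a $(d,1,G)$-well-conditioned basis of $A$; that is, $U$ has the same column space as $A$, $\|x\|_\infty\le\|Ux\|_G$ for all $x\in\mathbb{R}^d$, and $\sum_{i=1}^d\|U_i\|_G\le d$, where $U_i$ denotes the $i$-th column of $U$. -/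
open MeasureTheory ProbabilityTheory Real Filter
open scoped ENNReal NNReal

noncomputable section

theorem owcb_le_self {G : ℝ → ℝ} {CG : ℝ} (hG : PropertyP G CG) {t : ℝ} (h0 : 0 ≤ t) (h1 : t ≤ 1) :
    G t ≤ t := by
  have hc := hG.convex.2
  have h := @hc 0 (by simp) 1 (by simp) (1 - t) t (by linarith) h0 (by ring)
  simpa [hG.zero, hG.one] using h

theorem owcb_exists {G : ℝ → ℝ} {CG : ℝ} (hG : PropertyP G CG) {n : ℕ} (y : Fin n → ℝ) :
    ∃ α : ℝ, 0 < α ∧ ∑ i, G (|y i| / α) ≤ 1 := by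
  have hs : 0 ≤ ∑ i, |y i| := Finset.sum_nonneg fun i _ => abs_nonneg _
  have hα : 0 < 1 + ∑ i, |y i| := by linarith
  refine ⟨1 + ∑ i, |y i|, hα, ?_⟩
  calc ∑ i, G (|y i| / (1 + ∑ i, |y i|)) ≤ ∑ i, |y i| / (1 + ∑ i, |y i|) := by
        refine Finset.sum_le_sum fun i _ => owcb_le_self hG (by positivity) ?_
        rw [div_le_one hα]
        have := Finset.single_le_sum (f := fun i => |y i|) (fun i _ => abs_nonneg _)
          (Finset.mem_univ i)
        linarith
    _ = (∑ i, |y i|) / (1 + ∑ i, |y i|) := by rw [Finset.sum_div]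
    _ ≤ 1 := by rw [div_le_one hα]; linarith

theorem owcb_cont {G : ℝ → ℝ} {CG : ℝ} (hG : PropertyP G CG) : Continuous fun t => G |t| := by
  have h : ContinuousOn G (Set.Ici 0) := by
    intro x hx
    rcases eq_or_lt_of_le (Set.mem_Ici.1 hx) with h | h
    · subst h
      obtain ⟨_, _, _, c₁, c₂, h, _⟩ := hG.smooth
      exact h.continuousWithinAt
    · have := hG.convex.continuousOn_interior
      rw [interior_Ici] at this
      exact (this.continuousAt (Ioi_mem_nhds h)).continuousWithinAt
  exact h.comp_continuous continuous_abs fun x => abs_nonneg x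

theorem owcb_compact {G : ℝ → ℝ} {CG : ℝ} (hG : PropertyP G CG) (n : ℕ) :
    IsCompact {y : Fin n → ℝ | ∑ i, G |y i| ≤ 1} := by
  refine (isCompact_univ_pi (fun _ : Fin n => isCompact_Icc (a := (-1:ℝ)) (b := 1))).of_isClosed_subset
    ?_ ?_
  · refine isClosed_le (continuous_finsetSum _ fun i _ => ?_) continuous_const
    exact (owcb_cont hG).comp (continuous_apply i)
  · intro y hy i _
    have h1 : G |y i| ≤ 1 :=
      (Finset.single_le_sum (f := fun i => G |y i|) (fun i _ => hG.nonneg _)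
        (Finset.mem_univ i)).trans hy
    rw [Set.mem_Icc, ← abs_le]
    by_contra! h
    obtain ⟨s, hs, hl⟩ := hG.linear
    rw [hl _ h] at h1
    nlinarith

/-- Existence of a `(d, 1, G)`-well-conditioned (Auerbach) basis for the column space of a
rank-`d` matrix `A`, with respect to the Orlicz norm induced by `G`. -/
theorem orlicz_well_conditioned_basis (G : ℝ → ℝ) (CG : ℝ) (hG : PropertyP G CG)
    (n m d : ℕ) (A : Matrix (Fin n) (Fin m) ℝ) (hrank : A.rank = d) :
    ∃ U : Matrix (Fin n) (Fin d) ℝ,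
      ({y | ∃ x : Fin m → ℝ, y = A.mulVec x} : Set (Fin n → ℝ)) =
        {y | ∃ x : Fin d → ℝ, y = U.mulVec x} ∧
      (∀ x : Fin d → ℝ, linfNorm x ≤ OrliczNorm G (U.mulVec x)) ∧
      ∑ i : Fin d, OrliczNorm G (fun j => U j i) ≤ (d : ℝ) := by
  -- a linear parametrization of the column space
  let V := LinearMap.range A.mulVecLin
  have hV : Module.finrank ℝ V = d := hrank
  let b : Module.Basis (Fin d) ℝ V := Module.finBasisOfFinrankEq ℝ V hV
  let L : (Fin d → ℝ) →ₗ[ℝ] (Fin n → ℝ) := V.subtype ∘ₗ b.equivFun.symm.toLinearMap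
  have hLinj : Function.Injective L := V.injective_subtype.comp b.equivFun.symm.injective
  have hLmem : ∀ y, (∃ c, L c = y) ↔ ∃ x, A.mulVec x = y := by
    intro y
    constructor
    · rintro ⟨c, rfl⟩
      exact (b.equivFun.symm c).2
    · rintro ⟨x, hx⟩
      exact ⟨b.equivFun ⟨y, ⟨x, hx⟩⟩, by simp [L]⟩
  let K : Set (Fin n → ℝ) := {y | ∑ i, G |y i| ≤ 1}
  have hK : IsCompact K := owcb_compact hG n
  have hscale : ∀ (y : Fin n → ℝ) (α : ℝ), 0 < α → ∑ i, G (|y i| / α) ≤ 1 → α⁻¹ • y ∈ K := by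
    intro y α hα h
    have : ∀ i, |(α⁻¹ • y) i| = |y i| / α := by
      intro i
      simp [abs_mul, abs_of_pos hα]
      ring
    change ∑ i, G |(α⁻¹ • y) i| ≤ 1
    simpa only [this] using h
  let S : Set (Fin d → Fin d → ℝ) := Set.univ.pi fun _ => L ⁻¹' K
  have hS : IsCompact S := isCompact_univ_pi fun _ =>
    (LinearMap.isClosedEmbedding_of_injective (LinearMap.ker_eq_bot.2 hLinj)).isCompact_preimage hK
  have hex := fun i : Fin d => owcb_exists hG (L (Pi.single i 1))
  choose a ha haK using hex
  let D : Matrix (Fin d) (Fin d) ℝ := Matrix.diagonal fun i => (a i)⁻¹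
  have hD : (D : Fin d → Fin d → ℝ) ∈ S := by
    intro i _
    have : D i = (a i)⁻¹ • (Pi.single i 1 : Fin d → ℝ) := by
      ext j
      by_cases h : j = i
      · subst h; simp [D]
      · simp [D, h, Matrix.diagonal_apply_ne' _ h]
    change L (D i) ∈ K
    rw [this, map_smul]
    exact hscale _ _ (ha i) (haK i)
  have hDdet : 0 < |Matrix.det D| := by
    rw [Matrix.det_diagonal]
    exact abs_pos.2 (Finset.prod_ne_zero_iff.2 fun i _ => (inv_pos.2 (ha i)).ne')
  obtain ⟨C, hCS, hmax⟩ := hS.exists_isMaxOn ⟨D, hD⟩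
    (f := fun C : Fin d → Fin d → ℝ => |Matrix.det (Matrix.of C)|)
    (by
      apply Continuous.continuousOn
      exact (Continuous.matrix_det (continuous_id)).abs)
  have hCpos : 0 < |Matrix.det (Matrix.of C)| := hDdet.trans_le (hmax hD)
  have hCdet : IsUnit (Matrix.of C).det := (abs_pos.1 hCpos).isUnit
  let U : Matrix (Fin n) (Fin d) ℝ := Matrix.of fun j i => L (C i) j
  have hU : ∀ x, U.mulVec x = L (∑ k, x k • C k) := by
    intro x
    ext j
    simp [U, Matrix.mulVec, dotProduct, map_sum, mul_comm]
  refine ⟨U, ?_, ?_, ?_⟩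
  · ext y
    simp only [Set.mem_ofPred_eq]
    constructor
    · rintro ⟨x, hx⟩
      obtain ⟨c, hc⟩ := (hLmem y).2 ⟨x, hx.symm⟩
      refine ⟨Matrix.vecMul c (Matrix.of C)⁻¹, ?_⟩
      rw [hU, ← hc]
      congr 1
      have := Matrix.vecMul_eq_sum (Matrix.vecMul c (Matrix.of C)⁻¹) (Matrix.of C)
      rw [Matrix.vecMul_vecMul, Matrix.nonsing_inv_mul _ hCdet, Matrix.vecMul_one] at this
      exact this
    · rintro ⟨x, hx⟩
      rw [hU] at hx
      obtain ⟨z, hz⟩ := (hLmem y).1 ⟨_, hx.symm⟩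
      exact ⟨z, hz.symm⟩
  · intro x
    refine Real.iSup_le (fun i => ?_) (Real.sInf_nonneg fun α hα => hα.1.le)
    refine le_csInf (owcb_exists hG _) ?_
    rintro α ⟨hα, hα1⟩
    have h1 := hscale _ α hα hα1
    rw [hU, ← map_smul] at h1
    let M := (Matrix.of C).updateRow i (α⁻¹ • ∑ k, x k • (Matrix.of C) k)
    have hM : (M : Fin d → Fin d → ℝ) ∈ S := by
      intro k _
      change L (M k) ∈ K
      by_cases hk : k = i
      · subst hk
        simp only [M, Matrix.updateRow_self]
        exact h1
      · simp only [M, Matrix.updateRow_ne hk]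
        exact hCS k trivial
    have h2 : |Matrix.det M| ≤ |Matrix.det (Matrix.of C)| := hmax hM
    have h3 : Matrix.det M = α⁻¹ * (x i * (Matrix.of C).det) := by
      simp only [M]
      rw [Matrix.det_updateRow_smul, Matrix.det_updateRow_sum, smul_eq_mul]
    rw [h3, abs_mul, abs_mul, abs_of_pos (inv_pos.2 hα), ← mul_assoc] at h2
    have h4 := (mul_le_iff_le_one_left hCpos).1 h2
    rwa [inv_mul_le_iff₀ hα, mul_one] at h4
  · have : ∀ i ∈ Finset.univ, OrliczNorm G (fun j => U j i) ≤ (1:ℝ) := by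
      intro i _
      refine csInf_le ⟨0, fun α hα => hα.1.le⟩ ⟨one_pos, ?_⟩
      simp only [div_one]
      exact hCS i trivial
    simpa using Finset.sum_le_sum this
end
end
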